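/- Let Δ₀ : ℝ → ℝ be Lebesgue integrable, bounded and continuous, and define Δ(X,T) = ∫_ℝ G(X−Y,T) Δ₀(Y) dY for T > 0. Then for every real X, lim_{T→0⁺} Δ(X,T) = Δ₀(X); that is, the convolution with the Green's function recovers the initial profile as T → 0⁺. -/

import Mathlib

open MeasureTheory Real Filter

/-- The Green's function of the linearized capillary-driven thin film equation. -/
noncomputable def greenFn (X T : ℝ) : ℝ :=
  (1 / (2 * Real.pi)) * ∫ K : ℝ, Real.exp (-K ^ 4 * T) * Real.cos (K * X)

open scoped FourierTransform

lemma int_pow_exp (n : ℕ) : Integrable (fun x : ℝ => x ^ n * Real.exp (-x ^ 4)) := by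
  have h := (integrable_rpow_mul_exp_neg_mul_sq (b := 1) one_pos (s := (n : ℝ))
    (by have : (0 : ℝ) ≤ n := Nat.cast_nonneg n
        linarith)).norm.const_mul (Real.exp 1)
  refine h.mono' (by fun_prop) (Eventually.of_forall fun x => ?_)
  simp only [Real.rpow_natCast, norm_mul]
  have : Real.exp (-x ^ 4) ≤ Real.exp 1 * Real.exp (-1 * x ^ 2) := by
    rw [← Real.exp_add, Real.exp_le_exp]
    nlinarith [sq_nonneg (x ^ 2 - 1), sq_nonneg x]
  rw [Real.norm_of_nonneg (Real.exp_pos (-x ^ 4)).le,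
    Real.norm_of_nonneg (Real.exp_pos (-1 * x ^ 2)).le]
  nlinarith [mul_le_mul_of_nonneg_left this (norm_nonneg (x ^ n))]

noncomputable def ff (K : ℝ) : ℂ := ((Real.exp (-K ^ 4) : ℝ) : ℂ)
noncomputable def ff1 (K : ℝ) : ℂ := ((-4 * (K ^ 3 * Real.exp (-K ^ 4)) : ℝ) : ℂ)
noncomputable def ff2 (K : ℝ) : ℂ :=
  ((-12 * (K ^ 2 * Real.exp (-K ^ 4)) + 16 * (K ^ 6 * Real.exp (-K ^ 4)) : ℝ) : ℂ)

lemma hasDeriv_exp4 (x : ℝ) :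
    HasDerivAt (fun K : ℝ => Real.exp (-K ^ 4)) (Real.exp (-x ^ 4) * (-(4 * x ^ 3))) x := by
  simpa using ((hasDerivAt_pow 4 x).neg).exp

lemma ff_deriv (x : ℝ) : HasDerivAt ff (ff1 x) x := by
  unfold ff ff1
  refine HasDerivAt.ofReal_comp ?_
  convert hasDeriv_exp4 x using 1
  ring

lemma ff1_deriv (x : ℝ) : HasDerivAt ff1 (ff2 x) x := by
  unfold ff1 ff2
  refine HasDerivAt.ofReal_comp ?_
  refine (((hasDerivAt_pow 3 x).mul (hasDeriv_exp4 x)).const_mul (-4)).congr_deriv ?_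
  push_cast
  ring

lemma ff_int : Integrable ff := by
  have := (int_pow_exp 0).ofReal (𝕜 := ℂ)
  unfold ff
  simpa using! this

lemma ff1_int : Integrable ff1 := ((int_pow_exp 3).const_mul (-4)).ofReal (𝕜 := ℂ)

lemma ff2_int : Integrable ff2 :=
  (((int_pow_exp 2).const_mul (-12)).add ((int_pow_exp 6).const_mul 16)).ofReal (𝕜 := ℂ)

lemma fourier_bound (f : ℝ → ℂ) (w : ℝ) : ‖𝓕 f w‖ ≤ ∫ x, ‖f x‖ := by
  rw [Real.fourier_real_eq]
  refine (norm_integral_le_integral_norm _).trans (le_of_eq ?_)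
  simp

lemma Fff_int : Integrable (𝓕 ff) := by
  have d1 : deriv ff = ff1 := funext fun x => (ff_deriv x).deriv
  have d2 : deriv ff1 = ff2 := funext fun x => (ff1_deriv x).deriv
  have e1 := Real.fourier_deriv ff_int (fun x => (ff_deriv x).differentiableAt)
    (by rw [d1]; exact ff1_int)
  have e2 := Real.fourier_deriv ff1_int (fun x => (ff1_deriv x).differentiableAt)
    (by rw [d2]; exact ff2_int)
  rw [d1] at e1
  rw [d2] at e2
  have hc : Continuous (𝓕 ff) := VectorFourier.fourierIntegral_continuous
    Real.continuous_fourierChar (by exact continuous_inner) ff_int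
  refine (integrable_inv_one_add_sq.const_mul ((∫ x, ‖ff x‖) + ∫ x, ‖ff2 x‖)).mono'
    hc.aestronglyMeasurable (Eventually.of_forall fun w => ?_)
  have b0 := fourier_bound ff w
  have b2 := fourier_bound ff2 w
  rw [e2, e1] at b2
  simp only [norm_smul, norm_mul, Complex.norm_I, Complex.norm_real, Complex.norm_ofNat,
    Real.norm_eq_abs, abs_of_pos Real.pi_pos, mul_one] at b2
  have hw : 2 * π * |w| * (2 * π * |w| * ‖𝓕 ff w‖) = (2 * π) ^ 2 * (w ^ 2 * ‖𝓕 ff w‖) := by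
    rw [← sq_abs w]; ring
  rw [hw] at b2
  have hp : 1 ≤ (2 * π) ^ 2 := by nlinarith [Real.pi_gt_three]
  have h0 : 0 ≤ w ^ 2 * ‖𝓕 ff w‖ := by positivity
  rw [← div_eq_mul_inv, le_div_iff₀ (by positivity)]
  nlinarith

noncomputable def phi (w : ℝ) : ℝ := (𝓕 ff w).re

lemma phi_int : Integrable phi := Fff_int.re

lemma phi_integral : ∫ w, phi w = 1 := by
  have hc : ContinuousAt ff 0 := (ff_deriv 0).continuousAt
  have h := ff_int.fourierInv_fourier_eq Fff_int hc
  rw [Real.fourierInv_eq] at h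
  simp only [inner_zero_right, AddChar.map_zero_eq_one, one_smul] at h
  have h2 : ∫ w, phi w = (∫ w, 𝓕 ff w).re := integral_re Fff_int
  rw [h2, h]
  simp [ff]

lemma phi_eq (w : ℝ) : phi w = ∫ K : ℝ, Real.exp (-K ^ 4) * Real.cos (2 * π * w * K) := by
  unfold phi
  rw [Real.fourier_real_eq_integral_exp_smul]
  have hi : Integrable (fun v : ℝ => Complex.exp (↑(-2 * π * v * w) * Complex.I) • ff v) := by
    refine ff_int.norm.mono' ?_ (Eventually.of_forall fun v => ?_)
    · unfold ff; fun_prop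
    · rw [norm_smul, Complex.norm_exp_ofReal_mul_I, one_mul]
  refine (integral_re hi).symm.trans (integral_congr_ae (Eventually.of_forall fun v => ?_))
  simp only [ff, smul_eq_mul]
  change (_ : ℂ).re = _
  rw [Complex.re_mul_ofReal, Complex.exp_ofReal_mul_I_re, mul_comm, ← Real.cos_neg]
  congr 2
  ring

lemma green_eq (s : ℝ) (hs : 0 < s) (x : ℝ) :
    greenFn x (s ^ 4) = (2 * π * s)⁻¹ * phi ((2 * π * s)⁻¹ * x) := by
  have hpi := Real.pi_pos
  rw [phi_eq]
  unfold greenFn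
  have h := Measure.integral_comp_mul_left
    (fun K : ℝ => Real.exp (-K ^ 4) * Real.cos (2 * π * ((2 * π * s)⁻¹ * x) * K)) s
  have e : (fun K : ℝ => Real.exp (-K ^ 4 * s ^ 4) * Real.cos (K * x)) =
      fun K => Real.exp (-(s * K) ^ 4) * Real.cos (2 * π * ((2 * π * s)⁻¹ * x) * (s * K)) := by
    funext K
    congr 2
    · ring
    · field_simp
  rw [e, h, abs_of_pos (by positivity), smul_eq_mul, ← mul_assoc]
  congr 1
  field_simp

lemma conv_eq (f : ℝ → ℝ) (X s : ℝ) (hs : 0 < s) :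
    ∫ Y, greenFn (X - Y) (s ^ 4) * f Y = ∫ z, phi z * f (X - 2 * π * s * z) := by
  have hpi := Real.pi_pos
  have hc : 0 < (2 * π * s)⁻¹ := by positivity
  rw [← integral_sub_left_eq_self _ volume X]
  have h := Measure.integral_comp_mul_left
    (fun z : ℝ => phi z * f (X - 2 * π * s * z)) (2 * π * s)⁻¹
  rw [abs_of_pos (by positivity), smul_eq_mul, inv_inv] at h
  have e : (fun Y => greenFn (X - (X - Y)) (s ^ 4) * f (X - Y)) = fun Y =>
      (2 * π * s)⁻¹ * (phi ((2 * π * s)⁻¹ * Y) * f (X - 2 * π * s * ((2 * π * s)⁻¹ * Y))) := by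
    funext Y
    rw [green_eq s hs, sub_sub_cancel, mul_inv_cancel_left₀ (by positivity)]
    ring
  rw [e, integral_const_mul, h, inv_mul_cancel_left₀ (by positivity)]

/-- For a Lebesgue integrable, bounded and continuous initial profile `Δ₀`, the convolution
`Δ(X,T) = ∫ Y, G(X−Y,T) Δ₀(Y) dY` recovers the initial profile as `T → 0⁺`:
for every real `X`, `lim_{T→0⁺} Δ(X,T) = Δ₀(X)`. -/
theorem convolution_recovers_initial_profile (Δ₀ : ℝ → ℝ) (hΔ₀_int : Integrable Δ₀)
    (hΔ₀_bdd : ∃ C : ℝ, ∀ x : ℝ, |Δ₀ x| ≤ C) (hΔ₀_cont : Continuous Δ₀)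
    (Δ : ℝ → ℝ → ℝ) (hΔ : ∀ X T : ℝ, Δ X T = ∫ Y : ℝ, greenFn (X - Y) T * Δ₀ Y)
    (X : ℝ) :
    Tendsto (fun T : ℝ => Δ X T) (nhdsWithin 0 (Set.Ioi 0)) (nhds (Δ₀ X)) := by
  obtain ⟨C, hC⟩ := hΔ₀_bdd
  have hev : (fun T : ℝ => ∫ z, phi z * Δ₀ (X - 2 * π * T ^ (1 / 4 : ℝ) * z))
      =ᶠ[nhdsWithin 0 (Set.Ioi 0)] fun T => Δ X T := by
    filter_upwards [self_mem_nhdsWithin] with T hT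
    have hT' : 0 < T := hT
    rw [← conv_eq Δ₀ X _ (Real.rpow_pos_of_pos hT' _), hΔ]
    have : (T ^ (1 / 4 : ℝ)) ^ 4 = T := by
      rw [← Real.rpow_natCast, ← Real.rpow_mul hT'.le]
      norm_num
    rw [this]
  refine Tendsto.congr' hev ?_
  have hlim : Δ₀ X = ∫ z, phi z * Δ₀ X := by
    rw [integral_mul_const, phi_integral, one_mul]
  rw [hlim]
  refine tendsto_integral_filter_of_dominated_convergence (fun z => ‖phi z‖ * C) ?_ ?_ ?_ ?_
  · refine Eventually.of_forall fun T => phi_int.aestronglyMeasurable.mul ?_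
    exact (hΔ₀_cont.comp (by fun_prop)).aestronglyMeasurable
  · refine Eventually.of_forall fun T => Eventually.of_forall fun z => ?_
    rw [norm_mul]
    exact mul_le_mul_of_nonneg_left (hC _) (norm_nonneg _)
  · exact phi_int.norm.mul_const C
  · refine Eventually.of_forall fun z => ?_
    refine Tendsto.const_mul _ ?_
    have hc : Continuous fun T : ℝ => Δ₀ (X - 2 * π * T ^ (1 / 4 : ℝ) * z) := by
      have : Continuous fun T : ℝ => T ^ (1 / 4 : ℝ) :=
        Real.continuous_rpow_const (by norm_num)
      exact hΔ₀_cont.comp (by fun_prop)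
    have := (hc.tendsto 0).mono_left (nhdsWithin_le_nhds (s := Set.Ioi 0))
    simpa using this
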